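/- Let (X, ‖·‖) be a real normed space and let τ be a real number with −1 < τ < 0. Then there exists a constant C > 0 depending only on τ such that for all nonzero u, v ∈ X one has ‖ ‖u‖^τ • u − ‖v‖^τ • v ‖ ≤ C · (‖u‖ + ‖v‖)^τ · ‖u − v‖. -/

import Mathlib

/-- For `-1 ≤ τ ≤ 0`, the map `u ↦ ‖u‖ ^ τ • u` satisfies a Lipschitz-type bound governed by the
larger of the two norms. -/
theorem norm_rpow_smul_sub_le_of_norm_le {X : Type*} [NormedAddCommGroup X] [NormedSpace ℝ X]
    {τ : ℝ} (hτ1 : -1 ≤ τ) (hτ2 : τ ≤ 0) {u v : X} (hv : v ≠ 0) (h : ‖v‖ ≤ ‖u‖) :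
    ‖(‖u‖ ^ τ) • u - (‖v‖ ^ τ) • v‖ ≤ 2 * ‖u‖ ^ τ * ‖u - v‖ := by
  have hv0 : 0 < ‖v‖ := norm_pos_iff.mpr hv
  have hu0 : 0 < ‖u‖ := hv0.trans_le h
  have anti : ‖u‖ ^ τ ≤ ‖v‖ ^ τ := Real.rpow_le_rpow_of_nonpos hv0 h hτ2
  have mono : ‖v‖ ^ τ * ‖v‖ ≤ ‖u‖ ^ τ * ‖u‖ := by
    rw [← Real.rpow_add_one hv0.ne', ← Real.rpow_add_one hu0.ne']
    exact Real.rpow_le_rpow hv0.le h (by linarith)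
  have dist : ‖u‖ ^ τ * (‖u‖ - ‖v‖) ≤ ‖u‖ ^ τ * ‖u - v‖ :=
    mul_le_mul_of_nonneg_left (norm_sub_norm_le u v) (by positivity)
  calc ‖(‖u‖ ^ τ) • u - (‖v‖ ^ τ) • v‖
      = ‖(‖u‖ ^ τ) • (u - v) - (‖v‖ ^ τ - ‖u‖ ^ τ) • v‖ := by
        congr 1; module
    _ ≤ ‖(‖u‖ ^ τ) • (u - v)‖ + ‖(‖v‖ ^ τ - ‖u‖ ^ τ) • v‖ := norm_sub_le _ _
    _ = ‖u‖ ^ τ * ‖u - v‖ + (‖v‖ ^ τ - ‖u‖ ^ τ) * ‖v‖ := by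
        rw [norm_smul, norm_smul, Real.norm_of_nonneg (by positivity),
          Real.norm_of_nonneg (sub_nonneg.mpr anti)]
    _ ≤ 2 * ‖u‖ ^ τ * ‖u - v‖ := by linarith

/-- A nonpositive power of the larger of two numbers is controlled by that of their sum. -/
theorem rpow_le_half_rpow_mul_add_rpow {a b τ : ℝ} (hb : 0 < b) (h : b ≤ a) (hτ : τ ≤ 0) :
    a ^ τ ≤ (1 / 2) ^ τ * (a + b) ^ τ := by
  rw [← Real.mul_rpow (by norm_num) (by linarith)]
  exact Real.rpow_le_rpow_of_nonpos (by linarith) (by linarith) hτ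

/-- Upper bound for the V-functional for `-1 < τ < 0`, with constant depending only on `τ`. -/
theorem v_functional_upper_neg (τ : ℝ) (hτ1 : -1 < τ) (hτ2 : τ < 0) :
    ∃ C : ℝ, 0 < C ∧
      ∀ (X : Type*) [NormedAddCommGroup X] [NormedSpace ℝ X] (u v : X),
        u ≠ 0 → v ≠ 0 →
          ‖(‖u‖ ^ τ) • u - (‖v‖ ^ τ) • v‖ ≤ C * (‖u‖ + ‖v‖) ^ τ * ‖u - v‖ := by
  refine ⟨2 * (1 / 2) ^ τ, by positivity, fun X _ _ u v hu hv => ?_⟩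
  wlog h : ‖v‖ ≤ ‖u‖ generalizing u v
  · rw [norm_sub_rev, norm_sub_rev u v, add_comm ‖u‖]
    exact this v u hv hu (le_of_not_ge h)
  · refine (norm_rpow_smul_sub_le_of_norm_le hτ1.le hτ2.le hv h).trans ?_
    rw [mul_assoc 2 ((1 / 2 : ℝ) ^ τ)]
    gcongr
    exact rpow_le_half_rpow_mul_add_rpow (norm_pos_iff.mpr hv) h hτ2.le
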